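/- Let N ≥ 1, θ > 0, and let h_θ : (0,∞)^N → ℝ be a C² strictly convex function satisfying Hypothesis (H6a) and the uniform convexity bound (LMB21) with constant K > 0. Then for every μ ∈ ℝ^N: θ · Σ_{i,j=1}^N ∂²h*_θ/∂μ_i∂μ_j(μ) ≤ (N/K) · Σ_{i=1}^N ∂h*_θ/∂μ_i(μ). Equivalently, setting ρ = ∇h*_θ(μ) ∈ (0,∞)^N, one has θ·(∇²h_θ(ρ))^{-1}𝟙·𝟙 ≤ (N/K)·ρ̄, where 𝟙 = (1,…,1). -/

import Mathlib

open Filter Topology MeasureTheory Matrix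

noncomputable section

/-- The positive orthant `(0,∞)^N`. -/
def posOrth (N : ℕ) : Set (Fin N → ℝ) := {ρ | ∀ i, 0 < ρ i}

/-- Total density `ρ̄ = ∑ᵢ ρᵢ`. -/
def rbar {N : ℕ} (ρ : Fin N → ℝ) : ℝ := ∑ i, ρ i

/-- Gradient: the vector of partial derivatives. -/
def pgrad {N : ℕ} (h : (Fin N → ℝ) → ℝ) (ρ : Fin N → ℝ) : Fin N → ℝ :=
  fun i => fderiv ℝ h ρ (Pi.single i 1)

/-- Hessian matrix of second partial derivatives. -/
def phess {N : ℕ} (h : (Fin N → ℝ) → ℝ) (ρ : Fin N → ℝ) : Matrix (Fin N) (Fin N) ℝ :=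
  Matrix.of fun i j => fderiv ℝ (fun x => pgrad h x j) ρ (Pi.single i 1)

/-- Hypothesis (H6a): `h(ρ) → 0` and `∇h(ρ)·ρ → 0` as `ρ̄ → 0⁺`, `h(ρ)/ρ̄ → ∞` as
`ρ̄ → ∞`, and for each `i` and `R > 0`, `sup_{ρⱼ ∈ (0,R), j ≠ i} ∂h/∂ρᵢ(ρ) → -∞`
as `ρᵢ → 0⁺`. -/
def H6a {N : ℕ} (h : (Fin N → ℝ) → ℝ) : Prop :=
  Tendsto h (𝓟 (posOrth N) ⊓ Filter.comap (rbar (N := N)) (𝓝[>] (0:ℝ))) (𝓝 0) ∧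
  Tendsto (fun ρ : Fin N → ℝ => ∑ i, pgrad h ρ i * ρ i)
      (𝓟 (posOrth N) ⊓ Filter.comap (rbar (N := N)) (𝓝[>] (0:ℝ))) (𝓝 0) ∧
  Tendsto (fun ρ : Fin N → ℝ => h ρ / rbar ρ)
      (𝓟 (posOrth N) ⊓ Filter.comap (rbar (N := N)) atTop) atTop ∧
  ∀ i : Fin N, ∀ R > (0:ℝ), ∀ M : ℝ, ∃ ε > (0:ℝ), ∀ ρ ∈ posOrth N,
    ρ i < ε → (∀ j, j ≠ i → ρ j < R) → pgrad h ρ i < M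

/-- The convex conjugate (Legendre transform) `h*(μ) = sup_{ρ ∈ (0,∞)^N} (μ·ρ - h(ρ))`. -/
def hstar {N : ℕ} (h : (Fin N → ℝ) → ℝ) (μ : Fin N → ℝ) : ℝ :=
  sSup ((fun ρ => (∑ i, μ i * ρ i) - h ρ) '' posOrth N)

/-- The uniform convexity bound (LMB21): `∇²h(ρ)x·x ≥ (Kθ/ρ̄)|x|²`. -/
def LMB21 {N : ℕ} (h : (Fin N → ℝ) → ℝ) (θ K : ℝ) : Prop :=
  ∀ ρ ∈ posOrth N, ∀ x : Fin N → ℝ,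
    K * θ / rbar ρ * (∑ i, x i ^ 2) ≤ ∑ i, ∑ j, phess h ρ i j * x i * x j

theorem isOpen_posOrth (N : ℕ) : IsOpen (posOrth N) := by
  have : posOrth N = ⋂ i, {ρ : Fin N → ℝ | 0 < ρ i} := by
    ext ρ; simp [posOrth]
  rw [this]
  exact isOpen_iInter_of_finite fun i => isOpen_lt continuous_const (continuous_apply i)

theorem le_rbar {N : ℕ} {ρ : Fin N → ℝ} (hρ : ρ ∈ posOrth N) (i : Fin N) : ρ i ≤ rbar ρ :=
  Finset.single_le_sum (f := ρ) (fun j _ => (hρ j).le) (Finset.mem_univ i)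

theorem ContinuousLinearMap.apply_eq_sum_single {ι F : Type*} [Fintype ι] [DecidableEq ι]
    [NormedAddCommGroup F] [NormedSpace ℝ F] (L : (ι → ℝ) →L[ℝ] F) (x : ι → ℝ) :
    L x = ∑ i, x i • L (Pi.single i 1) := by
  have hs : ∀ i : ι, (fun j => if i = j then (1 : ℝ) else 0) = Pi.single i 1 := fun i => by
    ext j; simp [Pi.single_apply, eq_comm]
  have := L.toLinearMap.pi_apply_eq_sum_univ x
  simp only [hs] at this
  exact this

theorem fderiv_apply_eq_sum_pgrad {N : ℕ} (h : (Fin N → ℝ) → ℝ) (ρ x : Fin N → ℝ) :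
    fderiv ℝ h ρ x = ∑ i, x i * pgrad h ρ i :=
  (fderiv ℝ h ρ).apply_eq_sum_single x

theorem HasFDerivAt.pgrad_eq {N : ℕ} {h : (Fin N → ℝ) → ℝ} {f' : (Fin N → ℝ) →L[ℝ] ℝ}
    {ρ : Fin N → ℝ} (hf : HasFDerivAt h f' ρ) (i : Fin N) : pgrad h ρ i = f' (Pi.single i 1) := by
  rw [pgrad, hf.fderiv]

theorem contDiffAt_pgrad {N : ℕ} {h : (Fin N → ℝ) → ℝ} {ρ : Fin N → ℝ}
    (hh : ContDiffAt ℝ 2 h ρ) : ContDiffAt ℝ 1 (pgrad h) ρ := by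
  rw [contDiffAt_pi]
  intro i
  exact (hh.fderiv_right (m := 1) (by norm_num)).clm_apply contDiffAt_const

theorem HasFDerivAt.phess_eq {N : ℕ} {h : (Fin N → ℝ) → ℝ}
    {f' : (Fin N → ℝ) →L[ℝ] (Fin N → ℝ)} {ρ : Fin N → ℝ} (hf : HasFDerivAt (pgrad h) f' ρ)
    (i j : Fin N) : phess h ρ i j = f' (Pi.single i 1) j := by
  have := hasFDerivAt_pi'.1 hf j
  simp [phess, this.fderiv]

/-- The derivative of the gradient acts as the transpose of the Hessian matrix. -/
theorem HasFDerivAt.pgrad_apply {N : ℕ} {h : (Fin N → ℝ) → ℝ}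
    {f' : (Fin N → ℝ) →L[ℝ] (Fin N → ℝ)} {ρ : Fin N → ℝ} (hf : HasFDerivAt (pgrad h) f' ρ)
    (x : Fin N → ℝ) (j : Fin N) : f' x j = ∑ i, x i * phess h ρ i j := by
  have := congrFun (f'.apply_eq_sum_single x) j
  simpa [hf.phess_eq] using this

/-- First-order characterisation of strict convexity. -/
theorem StrictConvexOn.fderiv_lt_sub {E : Type*} [NormedAddCommGroup E] [NormedSpace ℝ E]
    {s : Set E} {h : E → ℝ} (hSC : StrictConvexOn ℝ s h) {ρ σ : E} (hρ : ρ ∈ s) (hσ : σ ∈ s)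
    (hne : ρ ≠ σ) (hd : DifferentiableAt ℝ h ρ) : fderiv ℝ h ρ (σ - ρ) < h σ - h ρ := by
  have hg : StrictConvexOn ℝ (Set.Icc (0 : ℝ) 1) (fun t => h (AffineMap.lineMap ρ σ t)) := by
    refine ⟨convex_Icc 0 1, fun x hx y hy hxy a b ha hb hab => ?_⟩
    have hmem : ∀ t ∈ Set.Icc (0 : ℝ) 1, AffineMap.lineMap ρ σ t ∈ s := fun t ht =>
      hSC.1.lineMap_mem hρ hσ ht
    have := hSC.2 (hmem x hx) (hmem y hy)
      (fun e => hxy (AffineMap.lineMap_injective ℝ hne e)) ha hb hab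
    rwa [← Convex.combo_affine_apply hab] at this
  have hd' : HasDerivAt (fun t : ℝ => h (AffineMap.lineMap ρ σ t)) (fderiv ℝ h ρ (σ - ρ)) 0 := by
    have h0 : HasFDerivAt h (fderiv ℝ h ρ) (AffineMap.lineMap ρ σ (0 : ℝ)) := by
      simpa using hd.hasFDerivAt
    exact h0.comp_hasDerivAt (0 : ℝ) AffineMap.hasDerivAt_lineMap
  have := hg.lt_slope_of_hasDerivAt (by simp) (by simp) one_pos hd'
  simpa [slope_def_field] using this

/-- Where `∂h/∂ρᵢ < μᵢ`, raising the `i`-th coordinate does not decrease `μ·ρ - h(ρ)`. -/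
theorem le_update_of_pgrad_lt {N : ℕ} {h : (Fin N → ℝ) → ℝ}
    (hd : ∀ ρ ∈ posOrth N, DifferentiableAt ℝ h ρ) (μ : Fin N → ℝ) {i : Fin N} {ε R : ℝ}
    (hε : ∀ ρ ∈ posOrth N, ρ i < ε → (∀ j, j ≠ i → ρ j < R) → pgrad h ρ i < μ i)
    {ρ : Fin N → ℝ} (hρ : ρ ∈ posOrth N) (hR : ∀ j, j ≠ i → ρ j < R) {t : ℝ}
    (hit : ρ i ≤ t) (ht : t < ε) :
    (∑ j, μ j * ρ j) - h ρ ≤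
      (∑ j, μ j * Function.update ρ i t j) - h (Function.update ρ i t) := by
  have hmem : ∀ s ∈ Set.Icc (ρ i) t, Function.update ρ i s ∈ posOrth N := by
    intro s hs j
    rcases eq_or_ne j i with rfl | hj
    · simpa using (hρ j).trans_le hs.1
    · simpa [hj] using hρ j
  have hder : ∀ s ∈ Set.Icc (ρ i) t, HasDerivAt
      (fun s => (∑ j, μ j * Function.update ρ i s j) - h (Function.update ρ i s))
      (μ i - pgrad h (Function.update ρ i s) i) s := by
    intro s hs
    have hu := hasDerivAt_update ρ i s
    have h1 := (hd _ (hmem s hs)).hasFDerivAt.comp_hasDerivAt s hu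
    have h2 : HasDerivAt (fun s => ∑ j, μ j * Function.update ρ i s j)
        (∑ j, μ j * (Pi.single i (1 : ℝ) : Fin N → ℝ) j) s :=
      HasDerivAt.fun_sum fun j _ => (hasDerivAt_pi.1 hu j).const_mul (μ j)
    have h3 : ∑ j, μ j * (Pi.single i (1 : ℝ) : Fin N → ℝ) j = μ i := by
      simp [Pi.single_apply]
    rw [h3] at h2
    exact h2.sub h1
  have hmono := monotoneOn_of_hasDerivWithinAt_nonneg (convex_Icc (ρ i) t)
    (fun s hs => (hder s hs).continuousAt.continuousWithinAt)
    (fun s hs => (hder s (interior_subset hs)).hasDerivWithinAt)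
    (fun s hs => by
      have hs := interior_subset hs
      refine sub_nonneg.2 (hε _ (hmem s hs) (by simpa using hs.2.trans_lt ht) ?_).le
      intro j hj
      simpa [hj] using hR j hj)
  simpa using hmono (Set.left_mem_Icc.2 hit) (Set.right_mem_Icc.2 hit) hit

theorem le_truncate_of_pgrad_lt {N : ℕ} {h : (Fin N → ℝ) → ℝ}
    (hd : ∀ ρ ∈ posOrth N, DifferentiableAt ℝ h ρ) (μ : Fin N → ℝ) {ε : Fin N → ℝ} {R δ : ℝ}
    (hε : ∀ i, ∀ ρ ∈ posOrth N, ρ i < ε i → (∀ j, j ≠ i → ρ j < R) → pgrad h ρ i < μ i)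
    (hδε : ∀ i, δ < ε i) (hδR : δ < R)
    {ρ : Fin N → ℝ} (hρ : ρ ∈ posOrth N) (hR : ∀ j, ρ j < R) (S : Finset (Fin N)) :
    (∑ j, μ j * ρ j) - h ρ ≤
      (∑ j, μ j * (if j ∈ S then max (ρ j) δ else ρ j)) -
        h (fun j => if j ∈ S then max (ρ j) δ else ρ j) := by
  induction S using Finset.induction_on with
  | empty => simp
  | insert i S hi ih =>
    refine ih.trans ?_
    set σ : Fin N → ℝ := fun j => if j ∈ S then max (ρ j) δ else ρ j with hσ
    have hσi : σ i = ρ i := by simp [hσ, hi]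
    have hup : (fun j => if j ∈ insert i S then max (ρ j) δ else ρ j) =
        Function.update σ i (max (ρ i) δ) := by
      ext j
      rcases eq_or_ne j i with rfl | hj
      · simp
      · simp [hj, hσ]
    have hup' : ∀ j, (if j ∈ insert i S then max (ρ j) δ else ρ j) =
        Function.update σ i (max (ρ i) δ) j := congrFun hup
    simp only [hup']
    rcases le_total δ (ρ i) with hle | hle
    · have : Function.update σ i (max (ρ i) δ) = σ := by
        rw [max_eq_left hle, ← hσi, Function.update_eq_self]
      rw [this]
    · rw [max_eq_right hle]
      refine le_update_of_pgrad_lt hd μ (hε i) (fun j => ?_) (fun j _ => ?_) (hσi.trans_le hle) (hδε i)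
      · by_cases hj : j ∈ S
        · simpa [hσ, hj] using Or.inl (hρ j)
        · simpa [hσ, hj] using hρ j
      · by_cases hj : j ∈ S
        · simpa [hσ, hj] using ⟨hR j, hδR⟩
        · simpa [hσ, hj] using hR j

/-- Under (H6a) the supremum defining the convex conjugate is attained in the open orthant. -/
theorem H6a.exists_maximizer {N : ℕ} {h : (Fin N → ℝ) → ℝ} (hH6 : H6a h)
    (hd : ∀ ρ ∈ posOrth N, DifferentiableAt ℝ h ρ) (μ : Fin N → ℝ) :
    ∃ σ ∈ posOrth N, ∀ ρ ∈ posOrth N,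
      (∑ j, μ j * ρ j) - h ρ ≤ (∑ j, μ j * σ j) - h σ := by
  obtain ⟨-, -, hsup, hbd⟩ := hH6
  set f : (Fin N → ℝ) → ℝ := fun ρ => (∑ j, μ j * ρ j) - h ρ with hf
  have hone : (fun _ => 1 : Fin N → ℝ) ∈ posOrth N := fun _ => one_pos
  set c := f (fun _ => 1) with hc
  set C := (∑ i, |μ i|) + |c| with hC
  have hev := hsup.eventually_ge_atTop C
  rw [inf_comm, Filter.eventually_inf_principal, Filter.eventually_comap,
    Filter.eventually_atTop] at hev
  obtain ⟨R₀, hR₀⟩ := hev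
  set R := max R₀ 2 with hR
  have hfar : ∀ ρ ∈ posOrth N, R ≤ rbar ρ → f ρ ≤ c := by
    intro ρ hρ hle
    have hr : 2 ≤ rbar ρ := (le_max_right _ _).trans hle
    have h1 : C * rbar ρ ≤ h ρ :=
      (le_div_iff₀ (by linarith)).1 (hR₀ _ ((le_max_left _ _).trans hle) ρ rfl hρ)
    have h2 : ∑ j, μ j * ρ j ≤ (∑ i, |μ i|) * rbar ρ := by
      rw [Finset.sum_mul]
      refine Finset.sum_le_sum fun j _ => ?_
      exact (mul_le_mul_of_nonneg_right (le_abs_self _) (hρ j).le).trans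
        (mul_le_mul_of_nonneg_left (le_rbar hρ j) (abs_nonneg _))
    have h3 : f ρ ≤ -(|c| * rbar ρ) := by
      simp only [hf, hC] at h1 ⊢
      linarith
    nlinarith [abs_nonneg c, neg_abs_le c]
  have hRpos : (0 : ℝ) < R := lt_of_lt_of_le two_pos (le_max_right _ _)
  choose ε hεpos hε using fun i => hbd i R hRpos (μ i)
  obtain ⟨δ, ⟨hδε, hδR⟩, hδ⟩ : ∃ δ : ℝ, ((∀ i, δ < ε i) ∧ δ < R) ∧ 0 < δ :=
    (((Filter.eventually_all.2 fun i => eventually_lt_nhds (hεpos i)).and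
      (eventually_lt_nhds hRpos)).filter_mono nhdsWithin_le_nhds |>.and
        self_mem_nhdsWithin : ∀ᶠ δ : ℝ in 𝓝[>] 0, ((∀ i, δ < ε i) ∧ δ < R) ∧ 0 < δ).exists
  have hbox : Set.Icc (fun _ => δ : Fin N → ℝ) (fun _ => R) ⊆ posOrth N :=
    fun ρ hρ i => hδ.trans_le (hρ.1 i)
  have hcont : ContinuousOn f (Set.Icc (fun _ => δ) (fun _ => R)) := by
    intro ρ hρ
    have := (hd ρ (hbox hρ)).continuousAt
    have hlin : Continuous fun ρ : Fin N → ℝ => ∑ j, μ j * ρ j := by fun_prop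
    exact (hlin.continuousAt.sub this).continuousWithinAt
  obtain ⟨σ, hσ, hmax⟩ := isCompact_Icc.exists_isMaxOn
    (Set.nonempty_Icc.2 fun _ => hδR.le) hcont
  have hnear : ∀ ρ ∈ posOrth N, (∀ j, ρ j < R) → f ρ ≤ f σ := by
    intro ρ hρ hlt
    have h1 := le_truncate_of_pgrad_lt hd μ hε hδε hδR hρ hlt Finset.univ
    simp only [Finset.mem_univ, if_true] at h1
    exact h1.trans (hmax ⟨fun j => le_max_right _ _, fun j => max_le (hlt j).le hδR.le⟩)
  refine ⟨σ, hbox hσ, fun ρ hρ => ?_⟩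
  by_cases hlt : ∀ j, ρ j < R
  · exact hnear ρ hρ hlt
  · obtain ⟨j, hj⟩ := not_forall.1 hlt
    exact (hfar ρ hρ ((not_lt.1 hj).trans (le_rbar hρ j))).trans
      (hnear _ hone fun _ => one_lt_two.trans_le (le_max_right _ _))

theorem hasFDerivAt_sum_mul {N : ℕ} (μ ρ : Fin N → ℝ) :
    HasFDerivAt (fun ρ : Fin N → ℝ => ∑ j, μ j * ρ j)
      (∑ j, μ j • ContinuousLinearMap.proj (R := ℝ) (φ := fun _ : Fin N => ℝ) j) ρ :=
  HasFDerivAt.fun_sum fun j _ => (hasFDerivAt_apply j ρ).const_mul (μ j)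

/-- Interior maximizers of `μ·ρ - h(ρ)` satisfy `∇h = μ`. -/
theorem pgrad_eq_of_maximizer {N : ℕ} {h : (Fin N → ℝ) → ℝ} {μ σ : Fin N → ℝ}
    (hd : DifferentiableAt ℝ h σ) (hσ : σ ∈ posOrth N)
    (hmax : ∀ ρ ∈ posOrth N, (∑ j, μ j * ρ j) - h ρ ≤ (∑ j, μ j * σ j) - h σ) :
    pgrad h σ = μ := by
  have hloc : IsLocalMax (fun ρ : Fin N → ℝ => (∑ j, μ j * ρ j) - h ρ) σ := by
    filter_upwards [(isOpen_posOrth N).mem_nhds hσ] with ρ hρ using hmax ρ hρ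
  have hz := hloc.hasFDerivAt_eq_zero ((hasFDerivAt_sum_mul μ σ).sub hd.hasFDerivAt)
  ext i
  have := DFunLike.congr_fun hz (Pi.single i 1)
  simp [Pi.single_apply] at this
  rw [pgrad]
  linarith

theorem hstar_eq_of_maximizer {N : ℕ} {h : (Fin N → ℝ) → ℝ} {μ σ : Fin N → ℝ}
    (hσ : σ ∈ posOrth N)
    (hmax : ∀ ρ ∈ posOrth N, (∑ j, μ j * ρ j) - h ρ ≤ (∑ j, μ j * σ j) - h σ) :
    hstar h μ = (∑ j, μ j * σ j) - h σ :=
  IsGreatest.csSup_eq ⟨⟨σ, hσ, rfl⟩, by rintro _ ⟨ρ, hρ, rfl⟩; exact hmax ρ hρ⟩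

theorem StrictConvexOn.injOn_pgrad {N : ℕ} {h : (Fin N → ℝ) → ℝ}
    (hSC : StrictConvexOn ℝ (posOrth N) h)
    (hd : ∀ ρ ∈ posOrth N, DifferentiableAt ℝ h ρ) : Set.InjOn (pgrad h) (posOrth N) := by
  intro ρ hρ σ hσ he
  by_contra hne
  have h1 := hSC.fderiv_lt_sub hρ hσ hne (hd ρ hρ)
  have h2 := hSC.fderiv_lt_sub hσ hρ (Ne.symm hne) (hd σ hσ)
  rw [fderiv_apply_eq_sum_pgrad, he, ← fderiv_apply_eq_sum_pgrad, ← neg_sub ρ σ, map_neg] at h1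
  linarith

theorem LMB21.eq_zero {N : ℕ} {h : (Fin N → ℝ) → ℝ} {θ K : ℝ} (hLMB : LMB21 h θ K)
    (hθ : 0 < θ) (hK : 0 < K) {ρ : Fin N → ℝ} (hρ : ρ ∈ posOrth N) {x : Fin N → ℝ}
    (hx : ∑ i, ∑ j, phess h ρ i j * x i * x j = 0) : x = 0 := by
  ext i
  have hr : 0 < rbar ρ := (hρ i).trans_le (le_rbar hρ i)
  have h1 := hLMB ρ hρ x
  rw [hx] at h1
  have h2 : x i ^ 2 ≤ ∑ j, x j ^ 2 :=
    Finset.single_le_sum (f := fun j => x j ^ 2) (fun j _ => sq_nonneg _) (Finset.mem_univ i)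
  have h3 : ∑ j, x j ^ 2 ≤ 0 := nonpos_of_mul_nonpos_right h1 (by positivity)
  exact pow_eq_zero_iff two_ne_zero |>.1 (le_antisymm (h2.trans h3) (sq_nonneg _))

theorem LMB21.isUnit_phess {N : ℕ} {h : (Fin N → ℝ) → ℝ} {θ K : ℝ} (hLMB : LMB21 h θ K)
    (hθ : 0 < θ) (hK : 0 < K) {ρ : Fin N → ℝ} (hρ : ρ ∈ posOrth N) : IsUnit (phess h ρ) := by
  rw [← Matrix.mulVec_injective_iff_isUnit]
  refine (injective_iff_map_eq_zero (phess h ρ).mulVecLin).2 fun x hx => ?_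
  refine hLMB.eq_zero hθ hK hρ ?_
  have : ∀ i, ∑ j, phess h ρ i j * x j = 0 := fun i => congrFun hx i
  calc _ = ∑ i, x i * ∑ j, phess h ρ i j * x j := by
        simp only [Finset.mul_sum]
        exact Finset.sum_congr rfl fun i _ => Finset.sum_congr rfl fun j _ => by ring
    _ = 0 := by simp [this]

/-- Under (LMB21), `∇h` has an invertible derivative at every point of the orthant. -/
theorem LMB21.exists_hasStrictFDerivAt_equiv {N : ℕ} {h : (Fin N → ℝ) → ℝ} {θ K : ℝ}
    (hLMB : LMB21 h θ K) (hθ : 0 < θ) (hK : 0 < K) {ρ : Fin N → ℝ} (hρ : ρ ∈ posOrth N)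
    (hC2 : ContDiffAt ℝ 2 h ρ) :
    ∃ e : (Fin N → ℝ) ≃L[ℝ] (Fin N → ℝ),
      HasStrictFDerivAt (pgrad h) (e : (Fin N → ℝ) →L[ℝ] (Fin N → ℝ)) ρ := by
  have hA := (contDiffAt_pgrad hC2).hasStrictFDerivAt one_ne_zero
  set A := fderiv ℝ (pgrad h) ρ
  have hinj : Function.Injective A.toLinearMap := by
    refine (injective_iff_map_eq_zero _).2 fun x hx => hLMB.eq_zero hθ hK hρ ?_
    have : ∀ j, ∑ i, x i * phess h ρ i j = 0 := fun j => by
      rw [← hA.hasFDerivAt.pgrad_apply]; exact congrFun hx j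
    calc _ = ∑ j, x j * ∑ i, x i * phess h ρ i j := by
          rw [Finset.sum_comm]
          simp only [Finset.mul_sum]
          exact Finset.sum_congr rfl fun i _ => Finset.sum_congr rfl fun j _ => by ring
      _ = 0 := by simp [this]
  refine ⟨(LinearEquiv.ofInjectiveEndo A.toLinearMap hinj).toContinuousLinearEquiv, ?_⟩
  have hAe : ((LinearEquiv.ofInjectiveEndo A.toLinearMap hinj).toContinuousLinearEquiv :
      (Fin N → ℝ) →L[ℝ] (Fin N → ℝ)) = A := by
    ext x j
    simp
  exact hA.congr_fderiv hAe.symm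

theorem HasStrictFDerivAt.hasFDerivAt_of_rightInverse_of_injOn {E F : Type*}
    [NormedAddCommGroup E] [NormedSpace ℝ E] [CompleteSpace E]
    [NormedAddCommGroup F] [NormedSpace ℝ F]
    {f : E → F} {e : E ≃L[ℝ] F} {g : F → E} {s : Set E} {y : F} (hs : IsOpen s)
    (hinj : Set.InjOn f s) (hg : ∀ z, g z ∈ s) (hfg : ∀ z, f (g z) = z)
    (hf : HasStrictFDerivAt f (e : E →L[ℝ] F) (g y)) :
    HasFDerivAt g (e.symm : F →L[ℝ] E) y := by
  have h1 := hf.to_localInverse.hasFDerivAt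
  have h2 := hf.eventually_right_inverse
  have h3 := hf.localInverse_tendsto.eventually (hs.mem_nhds (hg y))
  rw [hfg] at h1 h2 h3
  refine h1.congr_of_eventuallyEq ?_
  filter_upwards [h2, h3] with z hz hzs
  exact hinj (hg z) hzs ((hfg z).trans hz.symm)

/-- The convex conjugate has gradient `G` when `G(μ)` maximizes `μ·ρ - h(ρ)` and `G` is
differentiable. -/
theorem pgrad_hstar_eq {N : ℕ} {h : (Fin N → ℝ) → ℝ} {G : (Fin N → ℝ) → (Fin N → ℝ)}
    {μ : Fin N → ℝ} (hG : ∀ ν, hstar h ν = (∑ j, ν j * G ν j) - h (G ν))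
    (hGd : DifferentiableAt ℝ G μ) (hd : DifferentiableAt ℝ h (G μ))
    (hgrad : pgrad h (G μ) = μ) : pgrad (hstar h) μ = G μ := by
  obtain ⟨G', hG'⟩ := hGd
  have h1 : HasFDerivAt (fun ν : Fin N → ℝ => ∑ j, ν j * G ν j) _ μ :=
    HasFDerivAt.fun_sum fun j _ => (hasFDerivAt_apply j μ).mul (hasFDerivAt_pi'.1 hG' j)
  have h2 := h1.sub (hd.hasFDerivAt.comp μ hG')
  have h3 : HasFDerivAt (hstar h) _ μ := h2.congr_of_eventuallyEq (.of_forall hG)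
  ext i
  rw [h3.pgrad_eq]
  simp [fderiv_apply_eq_sum_pgrad, hgrad, Finset.sum_add_distrib, Pi.single_apply, mul_comm]

/-- If the quadratic form of the Hessian at `v` equals `𝟙·v`, then `θ 𝟙·v ≤ (N/K) ρ̄`. -/
theorem LMB21.mul_sum_le {N : ℕ} (hN : 1 ≤ N) {h : (Fin N → ℝ) → ℝ} {θ K : ℝ}
    (hLMB : LMB21 h θ K) (hθ : 0 < θ) (hK : 0 < K) {ρ : Fin N → ℝ} (hρ : ρ ∈ posOrth N)
    {v : Fin N → ℝ} (hv : ∑ i, ∑ j, phess h ρ i j * v i * v j = ∑ i, v i) :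
    θ * ∑ i, v i ≤ (N / K) * rbar ρ := by
  have hr : 0 < rbar ρ := (hρ ⟨0, hN⟩).trans_le (le_rbar hρ _)
  have h1 := hLMB ρ hρ v
  rw [hv, div_mul_eq_mul_div, div_le_iff₀ hr] at h1
  have h2 : (∑ i, v i) ^ 2 ≤ N * ∑ i, v i ^ 2 := by
    simpa using sq_sum_le_card_mul_sum_sq (s := Finset.univ) (f := v)
  rw [div_mul_eq_mul_div, le_div_iff₀ hK]
  set s := ∑ i, v i
  rcases le_or_gt s 0 with hs | hs
  · exact (mul_nonpos_of_nonpos_of_nonneg (mul_nonpos_of_nonneg_of_nonpos hθ.le hs) hK.le).trans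
      (by positivity)
  · refine le_of_mul_le_mul_right ?_ hs
    calc θ * s * K * s = K * θ * s ^ 2 := by ring
      _ ≤ K * θ * (N * ∑ i, v i ^ 2) := by gcongr
      _ = N * (K * θ * ∑ i, v i ^ 2) := by ring
      _ ≤ N * (s * rbar ρ) := by gcongr
      _ = N * rbar ρ * s := by ring

/-- Under (H6a) and (LMB21) with constant `K > 0`, for every `μ`:
`θ·∑_{i,j} ∂²h*/∂μᵢ∂μⱼ(μ) ≤ (N/K)·∑ᵢ ∂h*/∂μᵢ(μ)`; equivalently, with
`ρ = ∇h*(μ)`, `θ·(∇²h(ρ))⁻¹𝟙·𝟙 ≤ (N/K)·ρ̄`. -/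
theorem stmt3 (N : ℕ) (hN : 1 ≤ N) (θ K : ℝ) (hθ : 0 < θ) (hK : 0 < K)
    (h : (Fin N → ℝ) → ℝ)
    (hC2 : ContDiffOn ℝ 2 h (posOrth N))
    (hSC : StrictConvexOn ℝ (posOrth N) h)
    (hH6 : H6a h)
    (hLMB : LMB21 h θ K) :
    ∀ μ : Fin N → ℝ,
      θ * ∑ i, ∑ j, phess (hstar h) μ i j ≤ (N / K) * ∑ i, pgrad (hstar h) μ i ∧
      θ * (((phess h (pgrad (hstar h) μ))⁻¹ *ᵥ (fun _ => (1:ℝ))) ⬝ᵥ (fun _ => (1:ℝ)))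
        ≤ (N / K) * rbar (pgrad (hstar h) μ) := by
  have hC2' : ∀ ρ ∈ posOrth N, ContDiffAt ℝ 2 h ρ := fun ρ hρ =>
    hC2.contDiffAt ((isOpen_posOrth N).mem_nhds hρ)
  have hd : ∀ ρ ∈ posOrth N, DifferentiableAt ℝ h ρ := fun ρ hρ =>
    (hC2' ρ hρ).differentiableAt two_ne_zero
  choose G hGpos hGmax using hH6.exists_maximizer hd
  have hgrad : ∀ ν, pgrad h (G ν) = ν := fun ν =>
    pgrad_eq_of_maximizer (hd _ (hGpos ν)) (hGpos ν) (hGmax ν)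
  choose e he using fun ν => hLMB.exists_hasStrictFDerivAt_equiv hθ hK (hGpos ν) (hC2' _ (hGpos ν))
  have hGd : ∀ ν, HasFDerivAt G ((e ν).symm : (Fin N → ℝ) →L[ℝ] (Fin N → ℝ)) ν := fun ν =>
    (he ν).hasFDerivAt_of_rightInverse_of_injOn (isOpen_posOrth N) (hSC.injOn_pgrad hd) hGpos hgrad
  have hpg : pgrad (hstar h) = G := funext fun ν =>
    pgrad_hstar_eq (fun ν => hstar_eq_of_maximizer (hGpos ν) (hGmax ν))
      (hGd ν).differentiableAt (hd _ (hGpos ν)) (hgrad ν)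
  intro μ
  rw [hpg]
  constructor
  · have hGd' : HasFDerivAt (pgrad (hstar h))
        ((e μ).symm : (Fin N → ℝ) →L[ℝ] (Fin N → ℝ)) μ := hpg ▸ hGd μ
    set w := (e μ).symm (fun _ => 1) with hw
    have hsum : ∑ i, ∑ j, phess (hstar h) μ i j = ∑ j, w j := by
      refine Finset.sum_comm.trans (Finset.sum_congr rfl fun j _ => ?_)
      simpa using (hGd'.pgrad_apply (fun _ => 1) j).symm
    have hw1 : ∀ j, ∑ i, w i * phess h (G μ) i j = 1 := fun j => by
      rw [← (he μ).hasFDerivAt.pgrad_apply]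
      simp [hw]
    rw [hsum]
    refine hLMB.mul_sum_le hN hθ hK (hGpos μ) ?_
    calc _ = ∑ j, w j * ∑ i, w i * phess h (G μ) i j := by
          rw [Finset.sum_comm]
          simp only [Finset.mul_sum]
          exact Finset.sum_congr rfl fun i _ => Finset.sum_congr rfl fun j _ => by ring
      _ = ∑ j, w j := by simp [hw1]
  · set v := (phess h (G μ))⁻¹ *ᵥ (fun _ => (1 : ℝ)) with hv
    have hHv : phess h (G μ) *ᵥ v = fun _ => 1 := by
      rw [hv, Matrix.mulVec_mulVec, Matrix.mul_nonsing_inv _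
        ((Matrix.isUnit_iff_isUnit_det _).1 (hLMB.isUnit_phess hθ hK (hGpos μ))),
        Matrix.one_mulVec]
    have hv1 : ∀ i, ∑ j, phess h (G μ) i j * v j = 1 := fun i => congrFun hHv i
    have hdot : v ⬝ᵥ (fun _ => (1 : ℝ)) = ∑ i, v i := by simp [dotProduct]
    rw [hdot]
    refine hLMB.mul_sum_le hN hθ hK (hGpos μ) ?_
    calc _ = ∑ i, v i * ∑ j, phess h (G μ) i j * v j := by
          simp only [Finset.mul_sum]
          exact Finset.sum_congr rfl fun i _ => Finset.sum_congr rfl fun j _ => by ring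
      _ = ∑ i, v i := by simp [hv1]
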